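/- Let 2 ≤ k ≤ n and let λ ∈ Γ_k ⊂ ℝ^n. Then for all complex vectors X = (X_1,…,X_n) and Y = (Y_1,…,Y_n) in ℂ^n, Σ_{i ≠ j} ( σ_{k-2,ij}(λ) − σ_{k-1,i}(λ)σ_{k-1,j}(λ)/σ_k(λ) ) · ( (1/2)(|X_i|²|Y_j|² + |Y_i|²|X_j|²) − Re( X_i · conj(Y_i) · Y_j · conj(X_j) ) ) ≤ 0, where the sum is over ordered pairs of distinct indices i, j ∈ {1,…,n}. -/

import Mathlib

open Finset

/-- The `k`-th elementary symmetric polynomial of the values of `lam` on the index set `S`. -/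
noncomputable def esymmOn {n : ℕ} (S : Finset (Fin n)) (k : ℕ) (lam : Fin n → ℝ) : ℝ :=
  ∑ s ∈ S.powersetCard k, ∏ i ∈ s, lam i

/-- The `k`-th elementary symmetric polynomial `σ_k` on `ℝ^n`. -/
noncomputable def sigmaK (n k : ℕ) (lam : Fin n → ℝ) : ℝ :=
  esymmOn (Finset.univ : Finset (Fin n)) k lam

/-- The Gårding cone `Γ_k = {λ : σ_1(λ) > 0, …, σ_k(λ) > 0}`. -/
def GardingCone (n k : ℕ) : Set (Fin n → ℝ) :=
  {lam | ∀ j, 1 ≤ j → j ≤ k → 0 < sigmaK n j lam}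

open Polynomial in
lemma ci_splits_derivative {p : ℝ[X]} (hp : p.Splits) : (derivative p).Splits := by
  rw [splits_iff_card_roots] at hp ⊢
  apply le_antisymm (card_roots' _)
  have h1 := card_roots_le_derivative p
  have h2 := natDegree_derivative_le p
  omega

open Polynomial in
lemma ci_splits_iterate {p : ℝ[X]} (hp : p.Splits) (m : ℕ) : (derivative^[m] p).Splits := by
  induction m with
  | zero => simpa using hp
  | succ m ih =>
    rw [Function.iterate_succ_apply']
    exact ci_splits_derivative ih

open Polynomial in
lemma ci_newton_low_mul {p q : ℝ[X]} (hp : 2 * p.coeff 0 * p.coeff 2 ≤ p.coeff 1 ^ 2)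
    (hq : 2 * q.coeff 0 * q.coeff 2 ≤ q.coeff 1 ^ 2) :
    2 * (p * q).coeff 0 * (p * q).coeff 2 ≤ (p * q).coeff 1 ^ 2 := by
  have e0 : (p * q).coeff 0 = p.coeff 0 * q.coeff 0 := mul_coeff_zero p q
  have e1 : (p * q).coeff 1 = p.coeff 0 * q.coeff 1 + p.coeff 1 * q.coeff 0 := mul_coeff_one p q
  have e2 : (p * q).coeff 2 =
      p.coeff 0 * q.coeff 2 + p.coeff 1 * q.coeff 1 + p.coeff 2 * q.coeff 0 := by
    rw [coeff_mul]
    rw [Finset.Nat.sum_antidiagonal_eq_sum_range_succ_mk]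
    simp [Finset.sum_range_succ]
  rw [e0, e1, e2]
  nlinarith [mul_nonneg (sq_nonneg (q.coeff 0)) (sub_nonneg.2 hp),
    mul_nonneg (sq_nonneg (p.coeff 0)) (sub_nonneg.2 hq)]

open Polynomial in
lemma ci_newton_low {p : ℝ[X]} (hp : p.Splits) :
    2 * p.coeff 0 * p.coeff 2 ≤ p.coeff 1 ^ 2 := by
  obtain ⟨m, hm⟩ := splits_iff_exists_multiset.1 hp
  rw [hm]
  clear hm
  apply ci_newton_low_mul
  · simp [coeff_C]
  · induction m using Multiset.induction with
    | empty => simp [coeff_one]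
    | cons a m ih =>
      rw [Multiset.map_cons, Multiset.prod_cons]
      apply ci_newton_low_mul
      · simp [coeff_X, coeff_C]
      · exact ih

open Polynomial in
lemma ci_newton {p : ℝ[X]} (hp : p.Splits) (m : ℕ) :
    p.coeff m * p.coeff (m + 2) ≤ p.coeff (m + 1) ^ 2 := by
  have h := ci_newton_low (ci_splits_iterate hp m)
  simp only [coeff_iterate_derivative] at h
  have d0 : (0 + m).descFactorial m = m.factorial := by
    rw [zero_add, Nat.descFactorial_self]
  have d1 : (1 + m).descFactorial m = (m + 1) * m.factorial := by
    have := Nat.factorial_mul_descFactorial (n := 1 + m) (k := m) (by omega)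
    rw [show 1 + m - m = 1 by omega, add_comm 1 m, Nat.factorial_succ m] at this
    rw [add_comm 1 m]; simpa using this
  have d2 : 2 * (2 + m).descFactorial m = (m + 2) * ((m + 1) * m.factorial) := by
    have := Nat.factorial_mul_descFactorial (n := 2 + m) (k := m) (by omega)
    rw [show 2 + m - m = 2 by omega, add_comm 2 m, Nat.factorial_succ (m + 1),
      Nat.factorial_succ m] at this
    rw [add_comm 2 m]; simpa using this
  rw [d0, d1] at h
  simp only [nsmul_eq_mul] at h
  have d2' : (2 : ℝ) * ((2 + m).descFactorial m : ℝ) = (m + 2) * ((m + 1) * m.factorial) := by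
    exact_mod_cast d2
  rw [zero_add, add_comm 1 m, add_comm 2 m] at h
  rw [add_comm 2 m] at d2'
  push_cast at h
  have hf : (0 : ℝ) < m.factorial := by exact_mod_cast m.factorial_pos
  have hm : (0 : ℝ) ≤ m := Nat.cast_nonneg m
  set a := p.coeff m
  set b := p.coeff (m + 1)
  set c := p.coeff (m + 2)
  set f : ℝ := (m.factorial : ℝ)
  by_cases hac : a * c ≤ 0
  · exact hac.trans (sq_nonneg b)
  push Not at hac
  have h' : (f ^ 2 * (m + 1)) * ((m + 2) * (a * c)) ≤ (f ^ 2 * (m + 1)) * ((m + 1) * b ^ 2) := by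
    calc _ = f * a * (((m : ℝ) + 2) * ((m + 1) * f)) * c := by ring
      _ = 2 * (f * a) * (((m + 2).descFactorial m : ℝ) * c) := by rw [← d2']; ring
      _ ≤ _ := h
      _ = _ := by ring
  have h'' := le_of_mul_le_mul_left h' (by positivity)
  have : ((m : ℝ) + 1) * (a * c) ≤ (m + 1) * b ^ 2 := by nlinarith
  exact le_of_mul_le_mul_left this (by positivity)

lemma ci_insert {n : ℕ} (S : Finset (Fin n)) (i : Fin n) (hi : i ∉ S) (k : ℕ) (lam : Fin n → ℝ) :
    esymmOn (insert i S) (k + 1) lam = esymmOn S (k + 1) lam + lam i * esymmOn S k lam := by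
  unfold esymmOn
  rw [Finset.powersetCard_succ_insert hi, Finset.sum_union]
  · congr 1
    rw [Finset.sum_image, Finset.mul_sum]
    · refine Finset.sum_congr rfl fun s hs => ?_
      rw [Finset.prod_insert]
      exact fun h => hi ((Finset.mem_powersetCard.1 hs).1 h)
    · intro s hs t ht hst
      have hs' : i ∉ s := fun h => hi ((Finset.mem_powersetCard.1 hs).1 h)
      have ht' : i ∉ t := fun h => hi ((Finset.mem_powersetCard.1 ht).1 h)
      rw [← Finset.erase_insert hs', ← Finset.erase_insert ht']
      exact congrArg (fun u => u.erase i) hst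
  · rw [Finset.disjoint_left]
    intro s hs hs2
    obtain ⟨t, _, rfl⟩ := Finset.mem_image.1 hs2
    exact hi ((Finset.mem_powersetCard.1 hs).1 (Finset.mem_insert_self i t))

open Polynomial in
lemma ci_coeff {n : ℕ} (S : Finset (Fin n)) (lam : Fin n → ℝ) (k : ℕ) :
    (∏ i ∈ S, (C (lam i) * X + 1 : ℝ[X])).coeff k = esymmOn S k lam := by
  induction S using Finset.induction_on generalizing k with
  | empty =>
    cases k with
    | zero => simp [esymmOn]
    | succ k => 
      have : Finset.powersetCard (k + 1) (∅ : Finset (Fin n)) = ∅ :=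
        Finset.powersetCard_eq_empty.2 (by simp)
      simp [esymmOn, coeff_one, this]
  | insert i S hi ih =>
    rw [Finset.prod_insert hi, add_mul, one_mul, coeff_add, mul_assoc, coeff_C_mul]
    cases k with
    | zero => rw [coeff_X_mul_zero, ih]; simp [esymmOn]
    | succ k => rw [coeff_X_mul, ih, ih, ci_insert S i hi]; ring

lemma ci_esymm_newton {n : ℕ} (S : Finset (Fin n)) (lam : Fin n → ℝ) (m : ℕ) :
    esymmOn S m lam * esymmOn S (m + 2) lam ≤ esymmOn S (m + 1) lam ^ 2 := by
  simp only [← ci_coeff]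
  apply ci_newton
  refine Polynomial.Splits.prod fun i _ => ?_
  refine Polynomial.Splits.of_natDegree_le_one ?_
  have := Polynomial.natDegree_linear_le (a := lam i) (b := 1)
  simpa using this

/-- pointwise nonpositivity of the curvature integrand: for `2 ≤ k ≤ n`,
`lam ∈ Γ_k` and complex vectors `X, Y`,
`Σ_{i ≠ j} (σ_{k-2,ij} − σ_{k-1,i}σ_{k-1,j}/σ_k) ·
  ((1/2)(|X_i|²|Y_j|² + |Y_i|²|X_j|²) − Re(X_i conj(Y_i) Y_j conj(X_j))) ≤ 0`. -/
theorem curvature_integrand_nonpos (n k : ℕ) (hk2 : 2 ≤ k) (hkn : k ≤ n)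
    (lam : Fin n → ℝ) (hlam : lam ∈ GardingCone n k) (X Y : Fin n → ℂ) :
    ∑ i : Fin n, ∑ j ∈ Finset.univ.erase i,
      (esymmOn ((Finset.univ.erase i).erase j) (k - 2) lam -
          esymmOn (Finset.univ.erase i) (k - 1) lam *
            esymmOn (Finset.univ.erase j) (k - 1) lam / sigmaK n k lam) *
        ((1 / 2 : ℝ) * (‖X i‖ ^ 2 * ‖Y j‖ ^ 2 +
            ‖Y i‖ ^ 2 * ‖X j‖ ^ 2) -
          (X i * (starRingEnd ℂ) (Y i) * Y j * (starRingEnd ℂ) (X j)).re) ≤ 0 := by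
  apply Finset.sum_nonpos
  intro i _
  apply Finset.sum_nonpos
  intro j hj
  have hji : j ≠ i := Finset.ne_of_mem_erase hj
  have hpos : 0 < sigmaK n k lam := hlam k (by omega) le_rfl
  apply mul_nonpos_of_nonpos_of_nonneg
  · rw [sub_nonpos, le_div_iff₀ hpos]
    unfold sigmaK
    obtain ⟨m, rfl⟩ : ∃ m, k = m + 2 := ⟨k - 2, by omega⟩
    rw [show m + 2 - 2 = m by omega, show m + 2 - 1 = m + 1 by omega]
    set S := (Finset.univ.erase i).erase j with hS
    have hjS : j ∉ S := by simp [hS]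
    have hiS : i ∉ S := by simp [hS]
    have h1 : (Finset.univ.erase i : Finset (Fin n)) = insert j S := by
      rw [hS, Finset.insert_erase hj]
    have h2 : (Finset.univ.erase j : Finset (Fin n)) = insert i S := by
      ext x; simp only [hS, Finset.mem_erase, Finset.mem_insert, Finset.mem_univ]
      by_cases hx : x = i
      · subst hx; simp [hji.symm]
      · simp [hx]
    have h3 : (Finset.univ : Finset (Fin n)) = insert i (insert j S) := by
      rw [← h1, Finset.insert_erase (Finset.mem_univ i)]
    have hi' : i ∉ insert j S := by simp [hji.symm, hiS]
    rw [h1, h2, h3, ci_insert _ _ hi', ci_insert _ _ hjS, ci_insert _ _ hjS, ci_insert _ _ hiS]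
    nlinarith [ci_esymm_newton S lam m]
  · have key : (1 / 2 : ℝ) * (‖X i‖ ^ 2 * ‖Y j‖ ^ 2 + ‖Y i‖ ^ 2 * ‖X j‖ ^ 2) -
          (X i * (starRingEnd ℂ) (Y i) * Y j * (starRingEnd ℂ) (X j)).re =
        (1 / 2 : ℝ) * ‖X i * Y j - Y i * X j‖ ^ 2 := by
      simp only [Complex.sq_norm, Complex.normSq_apply, Complex.mul_re, Complex.mul_im,
        Complex.conj_re, Complex.conj_im, Complex.sub_re, Complex.sub_im]
      ring
    rw [key]
    positivity
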